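/- arXiv:1605.03326 — 2 statements merged into one kernel-verified Lean document; each statement's English description precedes it below -/
import Mathlib

section
/- Let α > -1/2 and let (Θ_p) be the sequence of kernels defined by Θ_{p}(x,y) = u_p(x,y) + v_p(x,y), where u_0(x,y) = sgn(x)/(2|x|^{2α+1}), v_0(x,y) = sgn(y)/(2|y|^{2α+1}), u_{p+1}(x,y) = ∫_{|y|}^{|x|} v_p(x,z) dz, and v_{p+1}(x,y) = (sgn(y)/|y|^{2α+1}) ∫_{|y|}^{|x|} u_p(x,z) |z|^{2α+1} dz. Then for every k ≥ 1 and x ≠ 0, ∫_{-|x|}^{|x|} |Θ_{k-1}(x,y)| |y|^{2α+1} dy ≤ b_k(|x|) + |x| b_{k-1}(|x|), and in particular this integral is ≤ C |x|^k for a constant C depending only on α and k. -/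
/-- The Dunkl–Taylor monomials: `b_{2m}(x) = (x/2)^{2m}/((α+1)_m m!)` and
`b_{2m+1}(x) = (x/2)^{2m+1}/((α+1)_{m+1} m!)`, with `(a)_m` the Pochhammer symbol. -/
noncomputable def dunklB (α : ℝ) (p : ℕ) (x : ℝ) : ℝ :=
  if Even p then (x / 2) ^ p / ((ascPochhammer ℝ (p / 2)).eval (α + 1) * (p / 2).factorial)
  else (x / 2) ^ p / ((ascPochhammer ℝ (p / 2 + 1)).eval (α + 1) * (p / 2).factorial)

/-- The pair of kernel sequences `(u_p, v_p)` from the generalized Taylor formula: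
`u_0(x,y) = sgn(x)/(2|x|^{2α+1})`, `v_0(x,y) = sgn(y)/(2|y|^{2α+1})`,
`u_{p+1}(x,y) = ∫_{|y|}^{|x|} v_p(x,z) dz`,
`v_{p+1}(x,y) = (sgn(y)/|y|^{2α+1}) ∫_{|y|}^{|x|} u_p(x,z) |z|^{2α+1} dz`. -/
noncomputable def dunklUV (α : ℝ) : ℕ → (ℝ → ℝ → ℝ) × (ℝ → ℝ → ℝ)
  | 0 => (fun x _ => Real.sign x / (2 * |x| ^ (2 * α + 1)),
          fun _ y => Real.sign y / (2 * |y| ^ (2 * α + 1)))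
  | p + 1 =>
      (fun x y => ∫ z in |y|..|x|, (dunklUV α p).2 x z,
       fun x y => Real.sign y / |y| ^ (2 * α + 1) *
          ∫ z in |y|..|x|, (dunklUV α p).1 x z * |z| ^ (2 * α + 1))

/-- The kernel `Θ_p = u_p + v_p`. -/
noncomputable def dunklTheta (α : ℝ) (p : ℕ) (x y : ℝ) : ℝ :=
  (dunklUV α p).1 x y + (dunklUV α p).2 x y

open MeasureTheory Set

/-- ENNReal majorants of `|u_p|`, `|v_p|`. -/
noncomputable def majUV (c a : ℝ) : ℕ → (ℝ → ENNReal) × (ℝ → ENNReal)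
  | 0 => (fun _ => ENNReal.ofReal (1 / (2 * a ^ c)), fun y => ENNReal.ofReal (1 / (2 * y ^ c)))
  | p + 1 =>
      (fun y => ∫⁻ z in Ioc y a, (majUV c a p).2 z,
       fun y => ENNReal.ofReal (1 / y ^ c) *
          ∫⁻ z in Ioc y a, (majUV c a p).1 z * ENNReal.ofReal (z ^ c))

/-- moment constants -/
noncomputable def momC (c : ℝ) : ℕ → (ℕ → ℝ) × (ℕ → ℝ)
  | 0 => (fun q => 1 / (2 * (c + q + 1)), fun q => 1 / (2 * (q + 1)))
  | p + 1 => (fun q => (momC c p).2 (q + 1) / (c + q + 1), fun q => (momC c p).1 (q + 1) / (q + 1))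

lemma anti_meas (f : ℝ → ENNReal) (a : ℝ) : Measurable (fun y => ∫⁻ z in Ioc y a, f z) := by
  apply Antitone.measurable
  intro y y' h
  exact lintegral_mono_set (Ioc_subset_Ioc_left h)

lemma maj_meas (c a : ℝ) (p : ℕ) :
    Measurable (majUV c a p).1 ∧ Measurable (majUV c a p).2 := by
  cases p with
  | zero =>
    constructor
    · exact measurable_const
    · show Measurable (fun y : ℝ => ENNReal.ofReal (1 / (2 * y ^ c)))
      fun_prop
  | succ p =>
    constructor
    · exact anti_meas _ _
    · show Measurable (fun y : ℝ => ENNReal.ofReal (1 / y ^ c) * _)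
      exact Measurable.mul (by fun_prop) (anti_meas _ _)

lemma lint_rpow (r z : ℝ) (hr : 0 ≤ r) (hz : 0 ≤ z) :
    ∫⁻ y in Ioc 0 z, ENNReal.ofReal (y ^ r) = ENNReal.ofReal (z ^ (r + 1) / (r + 1)) := by
  have h1 : IntervalIntegrable (fun y : ℝ => y ^ r) volume 0 z :=
    intervalIntegral.intervalIntegrable_rpow' (by linarith)
  rw [← ofReal_integral_eq_lintegral_ofReal]
  · rw [← intervalIntegral.integral_of_le hz, integral_rpow (Or.inl (by linarith)),
      Real.zero_rpow (by linarith)]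
    simp
  · exact (intervalIntegrable_iff_integrableOn_Ioc_of_le hz).1 h1
  · filter_upwards [ae_restrict_mem measurableSet_Ioc] with y hy
    exact Real.rpow_nonneg hy.1.le _

lemma tonelli_le (f : ℝ → ENNReal) (hf : Measurable f) (r a : ℝ) (hr : 0 ≤ r) :
    ∫⁻ y in Ioc 0 a, (∫⁻ z in Ioc y a, f z) * ENNReal.ofReal (y ^ r)
      ≤ ∫⁻ z in Ioc 0 a, f z * ENNReal.ofReal (z ^ (r + 1) / (r + 1)) := by
  have hg : Measurable (fun y : ℝ => ENNReal.ofReal (y ^ r)) := by fun_prop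
  set F : ℝ → ℝ → ENNReal := fun y z =>
    ({p : ℝ × ℝ | p.1 < p.2}).indicator (fun p => f p.2 * ENNReal.ofReal (p.1 ^ r)) (y, z) with hF
  have hFm : Measurable (Function.uncurry F) := by
    apply Measurable.indicator
    · exact (hf.comp measurable_snd).mul (hg.comp measurable_fst)
    · exact measurableSet_lt measurable_fst measurable_snd
  calc ∫⁻ y in Ioc 0 a, (∫⁻ z in Ioc y a, f z) * ENNReal.ofReal (y ^ r)
      ≤ ∫⁻ y in Ioc 0 a, ∫⁻ z in Ioc 0 a, F y z := by
        apply setLIntegral_mono' measurableSet_Ioc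
        intro y hy
        rw [← lintegral_mul_const _ hf]
        calc ∫⁻ z in Ioc y a, f z * ENNReal.ofReal (y ^ r) = ∫⁻ z in Ioc y a, F y z := by
              apply setLIntegral_congr_fun measurableSet_Ioc
              intro z hz
              simp [hF, hz.1]
          _ ≤ _ := lintegral_mono_set (Ioc_subset_Ioc_left hy.1.le)
    _ = ∫⁻ z in Ioc 0 a, ∫⁻ y in Ioc 0 a, F y z := lintegral_lintegral_swap hFm.aemeasurable
    _ ≤ _ := by
        apply setLIntegral_mono' measurableSet_Ioc
        intro z hz
        rw [← lint_rpow r z hr hz.1.le, ← lintegral_const_mul _ hg,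
          ← lintegral_indicator measurableSet_Ioc, ← lintegral_indicator measurableSet_Ioc]
        apply lintegral_mono
        intro y
        by_cases h : 0 < y
        · by_cases h2 : y < z
          · have : y ≤ a := h2.le.trans hz.2
            simp [hF, h, h2, h2.le, this, indicator]
          · simp [hF, h2, indicator]
        · simp [h]

lemma mom_bound (c a : ℝ) (hc : 0 < c) (ha : 0 < a) (p : ℕ) : ∀ q : ℕ,
    ∫⁻ y in Ioc 0 a, (majUV c a p).1 y * ENNReal.ofReal (y ^ (c + q))
        ≤ ENNReal.ofReal ((momC c p).1 q * a ^ (p + q + 1)) ∧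
    ∫⁻ y in Ioc 0 a, (majUV c a p).2 y * ENNReal.ofReal (y ^ (c + q))
        ≤ ENNReal.ofReal ((momC c p).2 q * a ^ (p + q + 1)) := by
  induction p with
  | zero =>
    intro q
    constructor
    · show ∫⁻ y in Ioc 0 a, ENNReal.ofReal (1 / (2 * a ^ c)) * ENNReal.ofReal (y ^ (c + q)) ≤ 
        ENNReal.ofReal (1 / (2 * (c + q + 1)) * a ^ (0 + q + 1))
      rw [lintegral_const_mul _ (by fun_prop), lint_rpow _ _ (by positivity) ha.le,
        ← ENNReal.ofReal_mul (by positivity)]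
      apply ENNReal.ofReal_le_ofReal
      apply le_of_eq
      rw [add_assoc c, Real.rpow_add ha, zero_add]
      have : a ^ ((q : ℝ) + 1) = a ^ (q + 1) := by exact_mod_cast Real.rpow_natCast a (q + 1)
      rw [this]
      have := Real.rpow_pos_of_pos ha c
      have : c + q + 1 ≠ 0 := by positivity
      field_simp
    · show ∫⁻ y in Ioc 0 a, ENNReal.ofReal (1 / (2 * y ^ c)) * ENNReal.ofReal (y ^ (c + q)) ≤ 
        ENNReal.ofReal (1 / (2 * (q + 1)) * a ^ (0 + q + 1))
      have : ∫⁻ y in Ioc 0 a, ENNReal.ofReal (1 / (2 * y ^ c)) * ENNReal.ofReal (y ^ (c + q))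
          = ∫⁻ y in Ioc 0 a, ENNReal.ofReal (1 / 2) * ENNReal.ofReal (y ^ (q : ℝ)) := by
        apply setLIntegral_congr_fun measurableSet_Ioc
        intro y hy
        have := Real.rpow_pos_of_pos hy.1 c
        simp only
        rw [← ENNReal.ofReal_mul (by positivity), ← ENNReal.ofReal_mul (by positivity),
          Real.rpow_add hy.1]
        congr 1
        field_simp
      rw [this, lintegral_const_mul _ (by fun_prop), lint_rpow _ _ (by positivity) ha.le,
        ← ENNReal.ofReal_mul (by positivity)]
      apply ENNReal.ofReal_le_ofReal
      apply le_of_eq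
      have : a ^ ((q : ℝ) + 1) = a ^ (q + 1) := by exact_mod_cast Real.rpow_natCast a (q + 1)
      rw [this, zero_add]
      field_simp
  | succ p ih =>
    intro q
    obtain ⟨ih1, ih2⟩ := ih (q + 1)
    obtain ⟨m1, m2⟩ := maj_meas c a p
    constructor
    · refine (tonelli_le _ m2 (c + q) a (by positivity)).trans ?_
      have : ∀ z : ℝ, (majUV c a p).2 z * ENNReal.ofReal (z ^ (c + q + 1) / (c + q + 1))
          = ENNReal.ofReal (1 / (c + q + 1)) *
            ((majUV c a p).2 z * ENNReal.ofReal (z ^ (c + (q + 1 : ℕ)))) := by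
        intro z
        rw [mul_left_comm, ← ENNReal.ofReal_mul (by positivity)]
        congr 2
        push_cast
        rw [← add_assoc]
        ring
      simp_rw [this]
      rw [lintegral_const_mul _ (by fun_prop)]
      refine (mul_le_mul_right ih2 _).trans ?_
      rw [← ENNReal.ofReal_mul (by positivity)]
      apply ENNReal.ofReal_le_ofReal
      apply le_of_eq
      show _ = (momC c p).2 (q + 1) / (c + q + 1) * a ^ (p + 1 + q + 1)
      rw [show p + (q + 1) + 1 = p + 1 + q + 1 by ring]
      ring
    · have e : ∫⁻ y in Ioc 0 a, (majUV c a (p + 1)).2 y * ENNReal.ofReal (y ^ (c + q))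
          = ∫⁻ y in Ioc 0 a, (∫⁻ z in Ioc y a, (majUV c a p).1 z * ENNReal.ofReal (z ^ c))
              * ENNReal.ofReal (y ^ (q : ℝ)) := by
        apply setLIntegral_congr_fun measurableSet_Ioc
        intro y hy
        have := Real.rpow_pos_of_pos hy.1 c
        show ENNReal.ofReal (1 / y ^ c) * _ * _ = _
        rw [mul_right_comm, ← ENNReal.ofReal_mul (by positivity), mul_comm, Real.rpow_add hy.1]
        congr 2
        field_simp
      rw [e]
      refine (tonelli_le _ (by fun_prop) q a (by positivity)).trans ?_
      have : ∫⁻ z in Ioc 0 a, (majUV c a p).1 z * ENNReal.ofReal (z ^ c)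
              * ENNReal.ofReal (z ^ ((q : ℝ) + 1) / (q + 1))
          = ∫⁻ z in Ioc 0 a, ENNReal.ofReal (1 / (q + 1)) *
            ((majUV c a p).1 z * ENNReal.ofReal (z ^ (c + (q + 1 : ℕ)))) := by
        apply setLIntegral_congr_fun measurableSet_Ioc
        intro z hz
        have := Real.rpow_pos_of_pos hz.1 c
        simp only
        rw [mul_left_comm, mul_assoc, ← ENNReal.ofReal_mul (by positivity),
          ← ENNReal.ofReal_mul (by positivity)]
        congr 2
        push_cast
        rw [Real.rpow_add hz.1 c]
        ring
      rw [this, lintegral_const_mul _ (by fun_prop)]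
      refine (mul_le_mul_right ih1 _).trans ?_
      rw [← ENNReal.ofReal_mul (by positivity)]
      apply ENNReal.ofReal_le_ofReal
      apply le_of_eq
      show _ = (momC c p).1 (q + 1) / (q + 1) * a ^ (p + 1 + q + 1)
      rw [show p + (q + 1) + 1 = p + 1 + q + 1 by ring]
      ring

lemma abs_sign_le (y : ℝ) : |Real.sign y| ≤ 1 := by
  rcases Real.sign_apply_eq y with h | h | h <;> rw [h] <;> norm_num

lemma enorm_le_maj (α x : ℝ) (hx : x ≠ 0) (p : ℕ) : ∀ y : ℝ, |y| ≤ |x| →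
    ‖(dunklUV α p).1 x y‖ₑ ≤ (majUV (2 * α + 1) |x| p).1 |y| ∧
    ‖(dunklUV α p).2 x y‖ₑ ≤ (majUV (2 * α + 1) |x| p).2 |y| := by
  induction p with
  | zero =>
    intro y hy
    constructor
    · show ‖Real.sign x / (2 * |x| ^ (2 * α + 1))‖ₑ ≤ ENNReal.ofReal (1 / (2 * |x| ^ (2 * α + 1)))
      rw [Real.enorm_eq_ofReal_abs]
      apply ENNReal.ofReal_le_ofReal
      have h : 0 ≤ 2 * |x| ^ (2 * α + 1) := by positivity
      rw [abs_div, abs_of_nonneg h]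
      exact div_le_div_of_nonneg_right (abs_sign_le x) h
    · show ‖Real.sign y / (2 * |y| ^ (2 * α + 1))‖ₑ ≤ ENNReal.ofReal (1 / (2 * |y| ^ (2 * α + 1)))
      rw [Real.enorm_eq_ofReal_abs]
      apply ENNReal.ofReal_le_ofReal
      have h : 0 ≤ 2 * |y| ^ (2 * α + 1) := by positivity
      rw [abs_div, abs_of_nonneg h]
      exact div_le_div_of_nonneg_right (abs_sign_le y) h
  | succ p ih =>
    intro y hy
    constructor
    · show ‖∫ z in |y|..|x|, (dunklUV α p).2 x z‖ₑ ≤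
        ∫⁻ z in Ioc |y| |x|, (majUV (2 * α + 1) |x| p).2 z
      rw [intervalIntegral.integral_of_le hy]
      refine (enorm_integral_le_lintegral_enorm _).trans ?_
      apply setLIntegral_mono' measurableSet_Ioc
      intro z hz
      have hz0 : |z| = z := abs_of_pos ((abs_nonneg y).trans_lt hz.1)
      have := (ih z (hz0.symm ▸ hz.2)).2
      rwa [hz0] at this
    · show ‖Real.sign y / |y| ^ (2 * α + 1) *
          ∫ z in |y|..|x|, (dunklUV α p).1 x z * |z| ^ (2 * α + 1)‖ₑ ≤
        ENNReal.ofReal (1 / |y| ^ (2 * α + 1)) *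
          ∫⁻ z in Ioc |y| |x|, (majUV (2 * α + 1) |x| p).1 z * ENNReal.ofReal (z ^ (2 * α + 1))
      rw [enorm_mul]
      apply mul_le_mul'
      · rw [Real.enorm_eq_ofReal_abs]
        apply ENNReal.ofReal_le_ofReal
        have h : 0 ≤ |y| ^ (2 * α + 1) := by positivity
        rw [abs_div, abs_of_nonneg h]
        exact div_le_div_of_nonneg_right (abs_sign_le y) h
      rw [intervalIntegral.integral_of_le hy]
      refine (enorm_integral_le_lintegral_enorm _).trans ?_
      apply setLIntegral_mono' measurableSet_Ioc
      intro z hz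
      have hz1 : 0 < z := ((abs_nonneg y).trans_lt hz.1)
      have hz0 : |z| = z := abs_of_pos hz1
      have := (ih z (hz0.symm ▸ hz.2)).1
      rw [hz0] at this ⊢
      rw [enorm_mul, Real.enorm_eq_ofReal (by positivity : 0 ≤ z ^ (2 * α + 1))]
      exact mul_le_mul_left this _

lemma lint_symm (g : ℝ → ENNReal) (hg : Measurable g) (a : ℝ) :
    ∫⁻ y in Ioc (-a) a, g |y| ≤ 2 * ∫⁻ y in Ioc 0 a, g y := by
  have h1 : ∫⁻ y in Ioc 0 a, g |y| = ∫⁻ y in Ioc 0 a, g y := by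
    apply setLIntegral_congr_fun measurableSet_Ioc
    intro y hy
    simp only [abs_of_pos hy.1]
  have h2 : ∫⁻ y in Ico (-a) 0, g |y| = ∫⁻ y in Ioc 0 a, g y := by
    rw [← h1, ← lintegral_indicator measurableSet_Ioc, ← lintegral_indicator measurableSet_Ico,
      ← lintegral_neg_eq_self]
    congr 1
    ext y
    simp only [indicator, mem_Ico, mem_Ioc, abs_neg]
    congr 1
    apply propext
    constructor <;> rintro ⟨h, h'⟩ <;> constructor <;> linarith
  have hs : Ioc (-a) a ⊆ (Ico (-a) 0 ∪ Ioc 0 a) ∪ {0} := by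
    intro y hy
    rcases lt_trichotomy y 0 with h | h | h
    · exact Or.inl (Or.inl ⟨hy.1.le, h⟩)
    · exact Or.inr h
    · exact Or.inl (Or.inr ⟨h, hy.2⟩)
  calc _ ≤ ∫⁻ y in (Ico (-a) 0 ∪ Ioc 0 a) ∪ {0}, g |y| := lintegral_mono_set hs
    _ ≤ (∫⁻ y in (Ico (-a) 0 ∪ Ioc 0 a), g |y|) + ∫⁻ y in {0}, g |y| := lintegral_union_le _ _ _
    _ ≤ ((∫⁻ y in (Ico (-a) 0), g |y|) + ∫⁻ y in Ioc 0 a, g |y|) + 0 := by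
      gcongr
      · exact lintegral_union_le _ _ _
      · simp
    _ = _ := by rw [h1, h2]; ring

lemma B_zero (α : ℝ) : dunklB α 0 1 = 1 := by simp [dunklB]

lemma asc_pos (α : ℝ) (hα : -1/2 < α) (n : ℕ) : 0 < (ascPochhammer ℝ n).eval (α + 1) :=
  ascPochhammer_pos n _ (by linarith)

lemma B_odd (α : ℝ) (hα : -1/2 < α) (j : ℕ) :
    dunklB α (2 * j + 1) 1 = dunklB α (2 * j) 1 / (2 * α + 1 + (2 * j : ℕ) + 1) := by
  have h1 : ¬ Even (2 * j + 1) := by simp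
  have h2 : (2 * j + 1) / 2 = j := by omega
  have h3 : 2 * j / 2 = j := by omega
  simp only [dunklB, h1, if_false, even_two_mul, if_true, h2, h3, ascPochhammer_succ_eval]
  have := asc_pos α hα j
  have h4 : 0 < α + 1 + j := by have : (0:ℝ) ≤ j := by positivity
                                linarith
  have h5 : 0 < 2 * α + 1 + 2 * j + 1 := by linarith
  push_cast
  rw [pow_succ]
  field_simp
  ring

lemma B_even (α : ℝ) (hα : -1/2 < α) (j : ℕ) :
    dunklB α (2 * j + 2) 1 = dunklB α (2 * j + 1) 1 / ((2 * j + 1 : ℕ) + 1) := by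
  have h1 : ¬ Even (2 * j + 1) := by simp
  have h0 : Even (2 * j + 2) := ⟨j + 1, by ring⟩
  have h2 : (2 * j + 1) / 2 = j := by omega
  have h3 : (2 * j + 2) / 2 = j + 1 := by omega
  simp only [dunklB, h1, if_false, h0, if_true, h2, h3, Nat.factorial_succ]
  have := asc_pos α hα (j + 1)
  push_cast
  rw [pow_succ _ (2 * j + 1)]
  field_simp
  ring

lemma B_pos (α : ℝ) (hα : -1/2 < α) (p : ℕ) : 0 < dunklB α p 1 := by
  unfold dunklB
  have := asc_pos α hα (p / 2)
  have := asc_pos α hα (p / 2 + 1)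
  split_ifs <;> positivity

lemma B_scale (α : ℝ) (p : ℕ) (x : ℝ) : dunklB α p x = dunklB α p 1 * x ^ p := by
  unfold dunklB
  split_ifs <;> · rw [div_pow, div_pow, one_pow]; ring

lemma mom_B (α : ℝ) (hα : -1/2 < α) (p : ℕ) : ∀ j : ℕ,
    2 * (momC (2 * α + 1) p).1 (2 * j) * dunklB α (2 * j) 1 = dunklB α (2 * j + p + 1) 1 ∧
    2 * (momC (2 * α + 1) p).2 (2 * j + 1) * dunklB α (2 * j + 1) 1
      = dunklB α (2 * j + p + 2) 1 := by
  induction p with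
  | zero =>
    intro j
    constructor
    · rw [add_zero, B_odd α hα]
      simp only [momC]
      rw [one_div, mul_inv]
      ring
    · rw [add_zero, B_even α hα]
      simp only [momC]
      rw [one_div, mul_inv]
      ring
  | succ p ih =>
    intro j
    constructor
    · rw [show 2 * j + (p + 1) + 1 = 2 * j + p + 2 by ring, ← (ih j).2, B_odd α hα]
      simp only [momC]
      ring
    · rw [show 2 * j + (p + 1) + 2 = 2 * (j + 1) + p + 1 by ring, ← (ih (j + 1)).1,
        show 2 * (j + 1) = 2 * j + 2 by ring, B_even α hα]
      simp only [momC]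
      ring

lemma mom_anti (c : ℝ) (hc : 0 < c) (p : ℕ) : ∀ q : ℕ,
    (0 ≤ (momC c p).1 (q + 1) ∧ (momC c p).1 (q + 1) ≤ (momC c p).1 q) ∧
    (0 ≤ (momC c p).2 (q + 1) ∧ (momC c p).2 (q + 1) ≤ (momC c p).2 q) := by
  induction p with
  | zero =>
    intro q
    simp only [momC]
    push_cast
    refine ⟨⟨by positivity, ?_⟩, by positivity, ?_⟩
    · apply one_div_le_one_div_of_le (by positivity); linarith
    · apply one_div_le_one_div_of_le (by positivity); linarith
  | succ p ih =>
    intro q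
    obtain ⟨⟨a1, a2⟩, a3, a4⟩ := ih (q + 1)
    simp only [momC]
    push_cast
    refine ⟨⟨by positivity, ?_⟩, by positivity, ?_⟩
    · apply div_le_div₀ (a3.trans a4) a4 (by positivity); linarith
    · apply div_le_div₀ (a1.trans a2) a2 (by positivity); linarith

lemma main_bound (α : ℝ) (hα : -1/2 < α) (p : ℕ) (x : ℝ) (hx : x ≠ 0) :
    ∫ y in (-|x|)..|x|, |dunklTheta α p x y| * |y| ^ (2 * α + 1)
      ≤ dunklB α (p + 1) |x| + |x| * dunklB α p |x| := by
  have hc : 0 < 2 * α + 1 := by linarith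
  have ha : 0 < |x| := abs_pos.2 hx
  obtain ⟨m1, m2⟩ := maj_meas (2 * α + 1) |x| p
  have hM : 2 * (momC (2 * α + 1) p).1 0 = dunklB α (p + 1) 1 := by
    have := (mom_B α hα p 0).1
    simpa [B_zero] using this
  have hM0 : 0 ≤ (momC (2 * α + 1) p).1 0 := by
    have := B_pos α hα (p + 1); linarith
  have hN : 2 * (momC (2 * α + 1) p).2 0 ≤ dunklB α p 1 ∧ 0 ≤ (momC (2 * α + 1) p).2 0 := by
    cases p with
    | zero => simp [momC, B_zero]
    | succ p =>
      have h1 := (mom_B α hα p 0).1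
      obtain ⟨h2, h3⟩ := (mom_anti _ hc p 0).1
      simp [B_zero] at h1
      simp only [momC]
      norm_num
      norm_num at h2 h3
      constructor <;> linarith
  have key : ‖∫ y in (-|x|)..|x|, |dunklTheta α p x y| * |y| ^ (2 * α + 1)‖ₑ ≤
      ENNReal.ofReal (dunklB α (p + 1) |x| + |x| * dunklB α p |x|) := by
    rw [intervalIntegral.integral_of_le (by linarith)]
    refine (enorm_integral_le_lintegral_enorm _).trans ?_
    set g : ℝ → ENNReal := fun y => (majUV (2 * α + 1) |x| p).1 y *
        ENNReal.ofReal (y ^ (2 * α + 1 + (0 : ℕ))) + (majUV (2 * α + 1) |x| p).2 y *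
        ENNReal.ofReal (y ^ (2 * α + 1 + (0 : ℕ))) with hgdef
    have hg : Measurable g := by fun_prop
    calc _ ≤ ∫⁻ y in Ioc (-|x|) |x|, g |y| := by
          apply setLIntegral_mono' measurableSet_Ioc
          intro y hy
          obtain ⟨h1, h2⟩ := enorm_le_maj α x hx p y (abs_le.2 ⟨hy.1.le, hy.2⟩)
          rw [enorm_mul, Real.enorm_abs, hgdef]
          simp only [Nat.cast_zero, add_zero]
          rw [Real.enorm_eq_ofReal (by positivity : 0 ≤ |y| ^ (2 * α + 1)), ← add_mul]
          exact mul_le_mul_left ((enorm_add_le _ _).trans (add_le_add h1 h2)) _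
      _ ≤ 2 * ∫⁻ y in Ioc 0 |x|, g y := lint_symm g hg _
      _ ≤ 2 * (ENNReal.ofReal ((momC (2 * α + 1) p).1 0 * |x| ^ (p + 0 + 1)) +
            ENNReal.ofReal ((momC (2 * α + 1) p).2 0 * |x| ^ (p + 0 + 1))) := by
          rw [hgdef, lintegral_add_left (by fun_prop)]
          obtain ⟨h1, h2⟩ := mom_bound (2 * α + 1) |x| hc ha p 0
          gcongr
      _ ≤ _ := by
          rw [← ENNReal.ofReal_add (by positivity) (mul_nonneg hN.2 (by positivity)),
            show (2 : ENNReal) = ENNReal.ofReal 2 by simp, ← ENNReal.ofReal_mul (by norm_num)]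
          apply ENNReal.ofReal_le_ofReal
          rw [B_scale α (p + 1), B_scale α p, ← hM, add_zero]
          have : 0 ≤ |x| ^ (p + 1) := by positivity
          have := mul_le_mul_of_nonneg_right hN.1 this
          rw [pow_succ] at *
          nlinarith
  rw [Real.enorm_eq_ofReal_abs] at key
  have hnn : 0 ≤ dunklB α (p + 1) |x| + |x| * dunklB α p |x| := by
    rw [B_scale α (p + 1), B_scale α p]
    have := B_pos α hα (p + 1)
    have := B_pos α hα p
    positivity
  exact (le_abs_self _).trans ((ENNReal.ofReal_le_ofReal_iff hnn).1 key)

/-- for `k ≥ 1` and `x ≠ 0`,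
`∫_{-|x|}^{|x|} |Θ_{k-1}(x,y)| |y|^{2α+1} dy ≤ b_k(|x|) + |x| b_{k-1}(|x|)`, and in
particular this integral is `≤ C |x|^k` for a constant `C` depending only on `α` and `k`. -/
theorem stmt4 (α : ℝ) (hα : -1/2 < α) (k : ℕ) (hk : 1 ≤ k) :
    (∀ x : ℝ, x ≠ 0 →
      ∫ y in (-|x|)..|x|, |dunklTheta α (k - 1) x y| * |y| ^ (2 * α + 1)
        ≤ dunklB α k |x| + |x| * dunklB α (k - 1) |x|) ∧
    ∃ C > 0, ∀ x : ℝ, x ≠ 0 →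
      ∫ y in (-|x|)..|x|, |dunklTheta α (k - 1) x y| * |y| ^ (2 * α + 1) ≤ C * |x| ^ k := by
  obtain ⟨p, rfl⟩ : ∃ p, k = p + 1 := ⟨k - 1, by omega⟩
  rw [Nat.add_sub_cancel]
  refine ⟨fun x hx => main_bound α hα p x hx, dunklB α (p + 1) 1 + dunklB α p 1,
    add_pos (B_pos α hα _) (B_pos α hα _), fun x hx => ?_⟩
  refine (main_bound α hα p x hx).trans (le_of_eq ?_)
  rw [B_scale α (p + 1), B_scale α p]
  ring
end

section
/- Let α > -1/2 and μ_α the measure on ℝ with density |x|^{2α+1}/(2^{α+1}Γ(α+1)) with respect to Lebesgue measure. For x, y ∈ ℝ \ {0}, the kernel W_α(x,y,·) of the Dunkl product formula satisfies ∫_ℝ |W_α(x,y,z)| dμ_α(z) ≤ √2. -/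
open MeasureTheory

/-- The weighted measure `dμ_α(x) = |x|^{2α+1}/(2^{α+1}Γ(α+1)) dx`. -/
noncomputable def dunklMeasure (α : ℝ) : Measure ℝ :=
  volume.withDensity fun x =>
    ENNReal.ofReal (|x| ^ (2 * α + 1) / (2 ^ (α + 1) * Real.Gamma (α + 1)))

/-- `b_{x,y,z} = (x²+y²-z²)/(2xy)` if `x,y ≠ 0`, and `0` otherwise. -/
noncomputable def dunklBCoef (x y z : ℝ) : ℝ :=
  if x ≠ 0 ∧ y ≠ 0 then (x ^ 2 + y ^ 2 - z ^ 2) / (2 * x * y) else 0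

/-- `Δ_α(x,y,z)`, supported on `|z| ∈ [||x|-|y||, |x|+|y|]`. -/
noncomputable def dunklDelta (α x y z : ℝ) : ℝ :=
  if |z| ∈ Set.Icc |(|x| - |y|)| (|x| + |y|) then
    (((|x| + |y|) ^ 2 - z ^ 2) * (z ^ 2 - (|x| - |y|) ^ 2)) ^ (α - 1/2) / |x * y * z| ^ (2 * α)
  else 0

/-- The kernel `W_α` of the Dunkl product formula. -/
noncomputable def dunklW (α x y z : ℝ) : ℝ :=
  Real.Gamma (α + 1) ^ 2 / (2 ^ (α - 1) * Real.sqrt Real.pi * Real.Gamma (α + 1/2)) *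
    (1 - dunklBCoef x y z + dunklBCoef z x y + dunklBCoef z y x) * dunklDelta α x y z


lemma aux_beta (a b : ℝ) (ha : 0 < a) (hb : 0 < b) :
    ∫⁻ t in Set.Ioo (0:ℝ) 1, ENNReal.ofReal (t ^ (a - 1) * (1 - t) ^ (b - 1))
      = ENNReal.ofReal (ProbabilityTheory.beta a b) := by
  have h := ProbabilityTheory.lintegral_betaPDF_eq_one ha hb
  rw [ProbabilityTheory.lintegral_betaPDF] at h
  have hB := ProbabilityTheory.beta_pos ha hb
  have h2 : ∀ t : ℝ, ENNReal.ofReal (t ^ (a - 1) * (1 - t) ^ (b - 1)) =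
      ENNReal.ofReal (ProbabilityTheory.beta a b) *
      ENNReal.ofReal (1 / ProbabilityTheory.beta a b * t ^ (a - 1) * (1 - t) ^ (b - 1)) := by
    intro t
    rw [← ENNReal.ofReal_mul hB.le]
    congr 1
    field_simp
  simp_rw [h2]
  rw [lintegral_const_mul' _ _ ENNReal.ofReal_ne_top, h, mul_one]

lemma aux_beta_lin (β p q K : ℝ) (hβ : 0 < β) (hp : 0 ≤ p) (hq : 0 ≤ q) (hK : 0 ≤ K) :
    ∫⁻ t in Set.Ioo (0:ℝ) 1,
      ENNReal.ofReal (K * (p * (1 - t) + q * t) * (t ^ (β - 1) * (1 - t) ^ (β - 1)))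
      = ENNReal.ofReal (K * (p + q) / 2 * ProbabilityTheory.beta β β) := by
  have hB := ProbabilityTheory.beta_pos hβ hβ
  have hG : Real.Gamma (2 * β) ≠ 0 := (Real.Gamma_pos_of_pos (by linarith)).ne'
  have e1 : ProbabilityTheory.beta β (β + 1) = ProbabilityTheory.beta β β / 2 := by
    unfold ProbabilityTheory.beta
    rw [show β + (β + 1) = 2 * β + 1 by ring, Real.Gamma_add_one hβ.ne',
      Real.Gamma_add_one (by linarith), ← two_mul]
    field_simp
  have e2 : ProbabilityTheory.beta (β + 1) β = ProbabilityTheory.beta β β / 2 := by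
    unfold ProbabilityTheory.beta
    rw [show β + 1 + β = 2 * β + 1 by ring, Real.Gamma_add_one hβ.ne',
      Real.Gamma_add_one (by linarith), ← two_mul]
    field_simp
  have key : ∀ t ∈ Set.Ioo (0:ℝ) 1,
      ENNReal.ofReal (K * (p * (1 - t) + q * t) * (t ^ (β - 1) * (1 - t) ^ (β - 1)))
      = ENNReal.ofReal (K * p) * ENNReal.ofReal (t ^ (β - 1) * (1 - t) ^ (β + 1 - 1))
        + ENNReal.ofReal (K * q) * ENNReal.ofReal (t ^ (β + 1 - 1) * (1 - t) ^ (β - 1)) := by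
    intro t ht
    have h1 : 0 < t := ht.1
    have h2 : 0 < 1 - t := by linarith [ht.2]
    rw [← ENNReal.ofReal_mul (by positivity), ← ENNReal.ofReal_mul (by positivity),
      ← ENNReal.ofReal_add (by positivity) (by positivity)]
    congr 1
    rw [show β + 1 - 1 = (β - 1) + 1 by ring, Real.rpow_add_one h1.ne', Real.rpow_add_one h2.ne']
    ring
  rw [setLIntegral_congr_fun measurableSet_Ioo key, lintegral_add_left (by fun_prop),
    lintegral_const_mul' _ _ ENNReal.ofReal_ne_top, lintegral_const_mul' _ _ ENNReal.ofReal_ne_top,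
    aux_beta _ _ hβ (by linarith), aux_beta _ _ (by linarith) hβ, e1, e2,
    ← ENNReal.ofReal_mul (by positivity), ← ENNReal.ofReal_mul (by positivity),
      ← ENNReal.ofReal_add (by positivity) (by positivity)]
  congr 1
  ring

/-- the signed factor -/
noncomputable def auxRho (x y z : ℝ) : ℝ :=
  1 - dunklBCoef x y z + dunklBCoef z x y + dunklBCoef z y x

lemma auxRho_eq (x y z : ℝ) (hx : x ≠ 0) (hy : y ≠ 0) (hz : z ≠ 0) :
    auxRho x y z = (z ^ 2 - (x - y) ^ 2) / (2 * (x * y)) * ((z + (x + y)) / z) := by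
  unfold auxRho dunklBCoef
  rw [if_pos ⟨hx, hy⟩, if_pos ⟨hz, hx⟩, if_pos ⟨hz, hy⟩]
  field_simp
  ring

lemma auxRho_bound (x y : ℝ) (hx : x ≠ 0) (hy : y ≠ 0) :
    ∃ p q : ℝ, 0 ≤ p ∧ 0 ≤ q ∧ p + q ≤ 4 * √2 ∧ ∀ t ∈ Set.Ioo (0:ℝ) 1, ∀ z : ℝ, 0 < z →
      z ^ 2 = (|x| - |y|) ^ 2 + 4 * (|x| * |y|) * t →
      |auxRho x y z| + |auxRho x y (-z)| ≤ p * (1 - t) + q * t := by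
  have ha : 0 < |x| := abs_pos.2 hx
  have hb : 0 < |y| := abs_pos.2 hy
  have hs2 : (√2) ^ 2 = 2 := Real.sq_sqrt (by norm_num)
  have hs1 : 1 ≤ √2 := by
    rw [show (1:ℝ) = √1 by simp]
    exact Real.sqrt_le_sqrt (by norm_num)
  have gen : ∀ z : ℝ, 0 < z → |auxRho x y z| + |auxRho x y (-z)| =
      |z ^ 2 - (x - y) ^ 2| / (2 * (|x| * |y|)) * ((|z + (x + y)| + |z - (x + y)|) / z) := by
    intro z hz
    rw [auxRho_eq x y z hx hy hz.ne', auxRho_eq x y (-z) hx hy (by linarith)]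
    simp only [abs_mul, abs_div, abs_neg, abs_of_pos hz, abs_two, neg_sq]
    rw [show -z + (x + y) = -(z - (x + y)) by ring, abs_neg]
    ring
  have hxa : |x| ^ 2 = x ^ 2 := sq_abs x
  have hya : |y| ^ 2 = y ^ 2 := sq_abs y
  have hxy : |x| * |y| = |x * y| := (abs_mul x y).symm
  rcases lt_or_gt_of_ne (mul_ne_zero hx hy) with hneg | hpos
  · refine ⟨4, 0, by norm_num, le_rfl, by linarith, ?_⟩
    intro t ht z hz hzt
    rw [gen z hz]
    rw [abs_of_neg hneg] at hxy
    have h1 : z ^ 2 - (x - y) ^ 2 = - (4 * (|x| * |y|) * (1 - t)) := by nlinarith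
    have h3 : 0 < |x| * |y| := by positivity
    have h2 : |x + y| ≤ z := by
      apply abs_le_of_sq_le_sq _ hz.le
      nlinarith [mul_pos h3 ht.1]
    rw [abs_le] at h2
    have h4 : 0 ≤ 4 * (|x| * |y|) * (1 - t) := by
      have := ht.2
      have : 0 ≤ 1 - t := by linarith
      positivity
    rw [h1, abs_neg, abs_of_nonneg h4, abs_of_nonneg (a := z + (x + y)) (by linarith),
      abs_of_nonneg (a := z - (x + y)) (by linarith)]
    apply le_of_eq
    field_simp
    ring
  · refine ⟨√2, 3 * √2, by positivity, by positivity, by linarith, ?_⟩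
    intro t ht z hz hzt
    rw [gen z hz]
    rw [abs_of_pos hpos] at hxy
    have h1 : z ^ 2 - (x - y) ^ 2 = 4 * (|x| * |y|) * t := by nlinarith
    have h3 : 0 < |x| * |y| := by positivity
    have ht0 : 0 < t := ht.1
    have h1t : 0 < 1 - t := by linarith [ht.2]
    have hS : |x + y| = |x| + |y| := by
      rw [abs_add_eq_add_abs_iff]
      rcases lt_or_gt_of_ne hx with h | h
      · right; exact ⟨h.le, by nlinarith⟩
      · left; exact ⟨h.le, by nlinarith⟩
    have h2 : z ≤ |x + y| := by
      rw [hS]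
      apply le_of_sq_le_sq _ (by positivity)
      nlinarith [mul_pos h3 h1t]
    have hsum : |z + (x + y)| + |z - (x + y)| = 2 * |x + y| := by
      rcases abs_cases (x + y) with ⟨h, h'⟩ | ⟨h, h'⟩
      · rw [h] at h2 ⊢
        rw [abs_of_nonneg (by linarith), abs_of_nonpos (by linarith)]; ring
      · rw [h] at h2 ⊢
        rw [abs_of_nonpos (by linarith), abs_of_nonneg (by linarith)]; ring
    rw [hsum, h1, abs_of_pos (by positivity), hS]
    -- z ≥ (|x|+|y|) √t
    set r := √t with hr
    have hr2 : r ^ 2 = t := Real.sq_sqrt ht0.le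
    have hr0 : 0 < r := Real.sqrt_pos.2 ht0
    have h5 : (|x| + |y|) * r ≤ z := by
      apply le_of_sq_le_sq _ hz.le
      rw [mul_pow, hr2, hzt]
      nlinarith [mul_nonneg h1t.le (sq_nonneg (|x| - |y|))]
    have h6 : 4 * (|x| * |y|) * t / (2 * (|x| * |y|)) * (2 * (|x| + |y|) / z) = 
        4 * r * ((|x| + |y|) * r / z) := by
      rw [← hr2]
      field_simp
    rw [h6]
    have h7 : (|x| + |y|) * r / z ≤ 1 := (div_le_one hz).2 h5
    have h8 : 4 * r * ((|x| + |y|) * r / z) ≤ 4 * r * 1 :=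
      mul_le_mul_of_nonneg_left h7 (by positivity)
    refine h8.trans ?_
    rw [← hr2]
    nlinarith [mul_nonneg (Real.sqrt_nonneg 2) (sq_nonneg (√2 * r - 1))]

/-- density times absolute value of the kernel -/
noncomputable def auxH (α x y z : ℝ) : ℝ :=
  |z| ^ (2 * α + 1) / (2 ^ (α + 1) * Real.Gamma (α + 1)) * |dunklW α x y z|

/-- the constant -/
noncomputable def auxK (α : ℝ) : ℝ :=
  Real.Gamma (α + 1) ^ 2 / (2 ^ (α - 1) * Real.sqrt Real.pi * Real.Gamma (α + 1/2)) /
    (2 ^ (α + 1) * Real.Gamma (α + 1)) * (2 * 4 ^ (2 * α - 1))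

lemma auxK_nonneg (α : ℝ) (hα : -1/2 < α) : 0 ≤ auxK α := by
  have h1 : 0 < Real.Gamma (α + 1) := Real.Gamma_pos_of_pos (by linarith)
  have h2 : 0 < Real.Gamma (α + 1/2) := Real.Gamma_pos_of_pos (by linarith)
  unfold auxK
  positivity

lemma auxK_beta (α : ℝ) (hα : -1/2 < α) :
    auxK α * 2 * ProbabilityTheory.beta (α + 1/2) (α + 1/2) = 1 := by
  have h1 : 0 < Real.Gamma (α + 1) := Real.Gamma_pos_of_pos (by linarith)
  have h2 : 0 < Real.Gamma (α + 1/2) := Real.Gamma_pos_of_pos (by linarith)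
  have h3 : 0 < Real.Gamma (2 * (α + 1/2)) := Real.Gamma_pos_of_pos (by linarith)
  have hd := Real.Gamma_mul_Gamma_add_half (α + 1/2)
  rw [show α + 1/2 + 1/2 = α + 1 by ring] at hd
  have hpi : 0 < √Real.pi := Real.sqrt_pos.2 Real.pi_pos
  have hP : (0:ℝ) < 2 ^ α := by positivity
  have e1 : (2:ℝ) ^ (α - 1) = 2 ^ α / 2 := by rw [Real.rpow_sub_one (by norm_num)]
  have e2 : (2:ℝ) ^ (α + 1) = 2 ^ α * 2 := by rw [Real.rpow_add_one (by norm_num)]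
  have e3 : (4:ℝ) ^ (2 * α - 1) = (2 ^ α) ^ 4 / 4 := by
    rw [Real.rpow_sub_one (by norm_num), show (4:ℝ) = 2 ^ (2:ℝ) by norm_num,
      ← Real.rpow_mul (by norm_num), ← Real.rpow_natCast, ← Real.rpow_mul (by norm_num)]
    congr 2
    push_cast; ring
  have e4 : (2:ℝ) ^ (1 - 2 * (α + 1/2)) = ((2 ^ α) ^ 2)⁻¹ := by
    rw [← Real.rpow_natCast, ← Real.rpow_mul (by norm_num), ← Real.rpow_neg (by norm_num)]
    congr 1
    push_cast; ring
  rw [e4] at hd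
  unfold auxK ProbabilityTheory.beta
  rw [e1, e2, e3, ← two_mul]
  generalize Real.Gamma (2 * (α + 1/2)) = G at *
  generalize Real.Gamma (α + 1/2) = H at *
  generalize (2:ℝ) ^ α = P at *
  field_simp at hd ⊢
  linarith

lemma auxH_eq (α x y t z w : ℝ) (hα : -1/2 < α) (hx : x ≠ 0) (hy : y ≠ 0)
    (ht : t ∈ Set.Ioo (0:ℝ) 1) (hz : 0 < z)
    (hzt : z ^ 2 = (|x| - |y|) ^ 2 + 4 * (|x| * |y|) * t) (hw : |w| = z) :
    2 * (|x| * |y|) / z * auxH α x y w =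
      auxK α * |auxRho x y w| * (t ^ (α + 1/2 - 1) * (1 - t) ^ (α + 1/2 - 1)) := by
  have h1 : 0 < Real.Gamma (α + 1) := Real.Gamma_pos_of_pos (by linarith)
  have h2 : 0 < Real.Gamma (α + 1/2) := Real.Gamma_pos_of_pos (by linarith)
  have hpi : 0 < √Real.pi := Real.sqrt_pos.2 Real.pi_pos
  have ha : 0 < |x| := abs_pos.2 hx
  have hb : 0 < |y| := abs_pos.2 hy
  have ht0 : 0 < t := ht.1
  have h1t : 0 < 1 - t := by linarith [ht.2]
  have hP : 0 < |x| * |y| := by positivity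
  have hw2 : w ^ 2 = z ^ 2 := by rw [← hw, sq_abs]
  have hmem : |w| ∈ Set.Icc |(|x| - |y|)| (|x| + |y|) := by
    rw [hw]
    constructor
    · apply abs_le_of_sq_le_sq _ hz.le
      nlinarith [mul_pos hP ht0]
    · apply le_of_sq_le_sq _ (by positivity)
      nlinarith [mul_pos hP h1t]
  have hD : dunklDelta α x y w = (4 ^ (2 * α - 1) * (t ^ (α + 1/2 - 1) * (1 - t) ^ (α + 1/2 - 1)))
      / (|x| * |y|) / z ^ (2 * α) := by
    unfold dunklDelta
    rw [if_pos hmem, hw2, hzt, show ((|x| + |y|) ^ 2 - ((|x| - |y|) ^ 2 + 4 * (|x| * |y|) * t)) *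
      ((|x| - |y|) ^ 2 + 4 * (|x| * |y|) * t - (|x| - |y|) ^ 2) =
      (4 * (|x| * |y|)) ^ (2:ℝ) * (t * (1 - t)) by rw [Real.rpow_two]; ring]
    rw [Real.mul_rpow (by positivity) (by positivity), Real.mul_rpow ht0.le h1t.le,
      ← Real.rpow_mul (by positivity), abs_mul, abs_mul, hw, Real.mul_rpow hP.le hz.le,
      show 2 * (α - 1/2) = 2 * α - 1 by ring, show α + 1/2 - 1 = α - 1/2 by ring,
      Real.mul_rpow (by norm_num) hP.le, Real.rpow_sub_one hP.ne']
    have : 0 < (|x| * |y|) ^ (2 * α) := by positivity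
    field_simp
  have hDn : 0 ≤ dunklDelta α x y w := by rw [hD]; positivity
  have hW : |dunklW α x y w| =
      Real.Gamma (α + 1) ^ 2 / (2 ^ (α - 1) * Real.sqrt Real.pi * Real.Gamma (α + 1/2)) *
      |auxRho x y w| * dunklDelta α x y w := by
    unfold dunklW auxRho
    rw [abs_mul, abs_mul, abs_of_nonneg hDn, abs_of_nonneg (by positivity)]
  unfold auxH auxK
  rw [hW, hD, hw, Real.rpow_add_one hz.ne']
  have : 0 < z ^ (2 * α) := by positivity
  field_simp

lemma aux_change (a b : ℝ) (ha : 0 < a) (hb : 0 < b) (g : ℝ → ENNReal) :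
    ∫⁻ z in Set.Ioo |a - b| (a + b), g z ≤
      ∫⁻ t in Set.Ioo (0:ℝ) 1, ENNReal.ofReal (2 * (a * b) / √((a - b) ^ 2 + 4 * (a * b) * t)) *
        g (√((a - b) ^ 2 + 4 * (a * b) * t)) := by
  have hP : 0 < a * b := by positivity
  have hpos : ∀ t ∈ Set.Ioo (0:ℝ) 1, 0 < (a - b) ^ 2 + 4 * (a * b) * t := by
    intro t ht
    have := ht.1
    positivity
  have hsub : Set.Ioo |a - b| (a + b) ⊆
      (fun t => √((a - b) ^ 2 + 4 * (a * b) * t)) '' Set.Ioo (0:ℝ) 1 := by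
    rintro z ⟨hz1, hz2⟩
    have hz0 : 0 < z := lt_of_le_of_lt (abs_nonneg _) hz1
    have h1 : (a - b) ^ 2 < z ^ 2 := by
      rw [← sq_abs (a - b)]
      exact pow_lt_pow_left₀ hz1 (abs_nonneg _) (by norm_num)
    have h2 : z ^ 2 < (a + b) ^ 2 := pow_lt_pow_left₀ hz2 hz0.le (by norm_num)
    refine ⟨(z ^ 2 - (a - b) ^ 2) / (4 * (a * b)), ⟨?_, ?_⟩, ?_⟩
    · apply div_pos <;> linarith
    · rw [div_lt_one (by positivity)]
      nlinarith
    · show √((a - b) ^ 2 + 4 * (a * b) * ((z ^ 2 - (a - b) ^ 2) / (4 * (a * b)))) = z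
      rw [mul_div_cancel₀ _ (by positivity), add_sub_cancel, Real.sqrt_sq hz0.le]
  refine (lintegral_mono_set hsub).trans ?_
  rw [lintegral_image_eq_lintegral_abs_deriv_mul (f' := fun t =>
    2 * (a * b) / √((a - b) ^ 2 + 4 * (a * b) * t)) measurableSet_Ioo]
  · apply le_of_eq
    apply setLIntegral_congr_fun measurableSet_Ioo
    intro t ht
    have := hpos t ht
    simp only
    rw [abs_of_nonneg (by positivity)]
  · intro t ht
    have h := hpos t ht
    have hd : HasDerivAt (fun t => (a - b) ^ 2 + 4 * (a * b) * t) (4 * (a * b)) t := by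
      simpa using ((hasDerivAt_id t).const_mul (4 * (a * b))).const_add ((a - b) ^ 2)
    have := (hd.sqrt h.ne').hasDerivWithinAt (s := Set.Ioo (0:ℝ) 1)
    have e : 2 * (a * b) / √((a - b) ^ 2 + 4 * (a * b) * t) =
        4 * (a * b) / (2 * √((a - b) ^ 2 + 4 * (a * b) * t)) := by
      rw [← mul_div_mul_left _ _ (two_ne_zero (α := ℝ))]
      congr 1
      ring
    simp only [e]
    exact this
  · intro t ht s hs hts
    simp only at hts
    rw [Real.sqrt_inj (hpos t ht).le (hpos s hs).le] at hts
    have : 4 * (a * b) * (t - s) = 0 := by linarith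
    rcases mul_eq_zero.1 this with h | h
    · linarith
    · linarith

lemma measurable_dunklW (α x y : ℝ) : Measurable (dunklW α x y) := by
  have hb1 : Measurable (fun z => dunklBCoef x y z) := by
    unfold dunklBCoef
    split_ifs <;> fun_prop
  have hb2 : ∀ u v, Measurable (fun z => dunklBCoef z u v) := by
    intro u v
    unfold dunklBCoef
    apply Measurable.ite _ (by fun_prop) (by fun_prop)
    by_cases hu : u = 0
    · simp [hu]
    · simp only [ne_eq, hu, not_false_eq_true, and_true]
      exact (measurableSet_singleton (0:ℝ)).compl
  have hd : Measurable (fun z => dunklDelta α x y z) := by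
    unfold dunklDelta
    apply Measurable.ite _ (by fun_prop) (by fun_prop)
    exact measurableSet_Icc.preimage (by fun_prop : Measurable fun z : ℝ => |z|)
  have := hb2 x y
  have := hb2 y x
  unfold dunklW
  fun_prop

lemma aux_fold (h : ℝ → ENNReal) (hm : Measurable h) (c d : ℝ)
    (h0 : ∀ z, |z| ∉ Set.Icc c d → h z = 0) :
    ∫⁻ z, h z ≤ ∫⁻ z in Set.Ioo c d, (h z + h (-z)) := by
  rw [lintegral_add_left hm, ← lintegral_indicator measurableSet_Ioo,
    ← lintegral_indicator measurableSet_Ioo,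
    ← lintegral_neg_eq_self (f := (Set.Ioo c d).indicator fun z => h (-z)),
    ← lintegral_add_left (hm.indicator measurableSet_Ioo)]
  apply lintegral_mono_ae
  have hfin : ({c, d, -c, -d} : Set ℝ).Finite := by simp
  filter_upwards [hfin.countable.ae_notMem volume] with z hz
  simp only [Set.mem_insert_iff, Set.mem_singleton_iff, not_or] at hz
  obtain ⟨z1, z2, z3, z4⟩ := hz
  by_cases hmem : |z| ∈ Set.Icc c d
  · rcases abs_cases z with ⟨e, _⟩ | ⟨e, _⟩
    · have : z ∈ Set.Ioo c d := by
        rw [e] at hmem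
        exact ⟨lt_of_le_of_ne hmem.1 (Ne.symm z1), lt_of_le_of_ne hmem.2 z2⟩
      rw [Set.indicator_of_mem this]
      exact le_self_add
    · have : -z ∈ Set.Ioo c d := by
        rw [e] at hmem
        exact ⟨lt_of_le_of_ne hmem.1 (fun h => z3 (by linarith)),
          lt_of_le_of_ne hmem.2 (fun h => z4 (by linarith))⟩
      rw [Set.indicator_of_mem this, neg_neg]
      exact le_add_self
  · rw [h0 z hmem]
    exact zero_le

/-- for `x, y ≠ 0`, `∫_ℝ |W_α(x,y,z)| dμ_α(z) ≤ √2`. -/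
theorem stmt5 (α : ℝ) (hα : -1/2 < α) (x y : ℝ) (hx : x ≠ 0) (hy : y ≠ 0) :
    ∫ z, |dunklW α x y z| ∂(dunklMeasure α) ≤ Real.sqrt 2 := by
  have hmW := measurable_dunklW α x y
  have ha : 0 < |x| := abs_pos.2 hx
  have hb : 0 < |y| := abs_pos.2 hy
  have h1 : 0 < Real.Gamma (α + 1) := Real.Gamma_pos_of_pos (by linarith)
  rw [integral_eq_lintegral_of_nonneg_ae (Filter.Eventually.of_forall fun z => abs_nonneg _)
    (by fun_prop)]
  apply ENNReal.toReal_le_of_le_ofReal (Real.sqrt_nonneg 2)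
  unfold dunklMeasure
  rw [lintegral_withDensity_eq_lintegral_mul _ (by fun_prop) (by fun_prop)]
  have e : ∀ z, ((fun x => ENNReal.ofReal (|x| ^ (2 * α + 1) / (2 ^ (α + 1) * Real.Gamma (α + 1))))
      * fun z => ENNReal.ofReal |dunklW α x y z|) z = ENNReal.ofReal (auxH α x y z) := by
    intro z
    unfold auxH
    rw [Pi.mul_apply, ← ENNReal.ofReal_mul (by positivity)]
  simp_rw [e]
  have hHn : ∀ z, 0 ≤ auxH α x y z := by
    intro z
    unfold auxH
    positivity
  obtain ⟨p, q, hp, hq, hpq, hbd⟩ := auxRho_bound x y hx hy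
  refine (aux_fold _ (by unfold auxH; fun_prop) |(|x| - |y|)| (|x| + |y|) ?_).trans ?_
  · intro z hz
    unfold auxH dunklW dunklDelta
    rw [if_neg hz]
    simp
  refine (aux_change |x| |y| ha hb _).trans ?_
  calc _ ≤ ∫⁻ t in Set.Ioo (0:ℝ) 1, ENNReal.ofReal (auxK α * (p * (1 - t) + q * t) *
        (t ^ (α + 1/2 - 1) * (1 - t) ^ (α + 1/2 - 1))) := by
        apply setLIntegral_mono' measurableSet_Ioo
        intro t ht
        have ht0 : 0 < t := ht.1
        have h1t : 0 < 1 - t := by linarith [ht.2]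
        have hpos : 0 < (|x| - |y|) ^ 2 + 4 * (|x| * |y|) * t := by positivity
        have hz2 := Real.sq_sqrt hpos.le
        have hz : 0 < √((|x| - |y|) ^ 2 + 4 * (|x| * |y|) * t) := Real.sqrt_pos.2 hpos
        set z := √((|x| - |y|) ^ 2 + 4 * (|x| * |y|) * t) with hzdef
        rw [← ENNReal.ofReal_add (hHn _) (hHn _), ← ENNReal.ofReal_mul (by positivity)]
        apply ENNReal.ofReal_le_ofReal
        rw [mul_add, auxH_eq α x y t z z hα hx hy ht hz hz2 (abs_of_pos hz),
          auxH_eq α x y t z (-z) hα hx hy ht hz hz2 (by rw [abs_neg, abs_of_pos hz]), ← add_mul,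
          ← mul_add]
        have := hbd t ht z hz hz2
        have := auxK_nonneg α hα
        gcongr
    _ = ENNReal.ofReal (auxK α * (p + q) / 2 * ProbabilityTheory.beta (α + 1/2) (α + 1/2)) :=
        aux_beta_lin _ _ _ _ (by linarith) hp hq (auxK_nonneg α hα)
    _ ≤ ENNReal.ofReal √2 := by
        apply ENNReal.ofReal_le_ofReal
        have hk := auxK_beta α hα
        have : auxK α * (p + q) / 2 * ProbabilityTheory.beta (α + 1/2) (α + 1/2) =
          (p + q) / 4 * (auxK α * 2 * ProbabilityTheory.beta (α + 1/2) (α + 1/2)) := by ring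
        rw [this, hk]
        linarith
end
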